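/- arXiv:1510.00722 — 2 statements merged into one kernel-verified Lean document; each statement's English description precedes it below -/
import Mathlib

section
/- Let Γ ⊂ ℤ^n be an almost periodic pattern, ε > 0, δ > 0 and A ∈ GL_n(ℝ). Then there exist R_{ε,δ} > 0 and a relatively dense set Ñ_{ε,δ} ⊂ ℤ^n such that: (a) for every R ≥ R_{ε,δ} and every v ∈ Ñ_{ε,δ}, D_R^+((Γ+v) Δ Γ) < ε; (b) for every v ∈ Ñ_{ε,δ}, d_∞(A v, ℤ^n) < δ; and (c) for every i ∈ I_ℚ(A) and every v ∈ Ñ_{ε,δ}, the i-th coordinate (A v)_i belongs to ℤ. -/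
open Filter MeasureTheory
open scoped BigOperators

noncomputable section

/-- The projection `p : ℝ → ℤ`: the unique `k` with `k - 1/2 < x ≤ k + 1/2`. -/
def roundHalf (x : ℝ) : ℤ := ⌈x - 1/2⌉

/-- Coercion of an integer vector to a real vector. -/
def intVec {n : ℕ} (v : Fin n → ℤ) : Fin n → ℝ := fun i => (v i : ℝ)

/-- The set of integer points of `ℝ^n`. -/
def intPoints (n : ℕ) : Set (Fin n → ℝ) := Set.range (intVec (n := n))

/-- The coordinatewise projection `π : ℝ^n → ℤ^n`. -/
def discretize {n : ℕ} (x : Fin n → ℝ) : Fin n → ℤ := fun i => roundHalf (x i)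

/-- `π` viewed as a self-map of `ℝ^n`. -/
def discretizeR {n : ℕ} (x : Fin n → ℝ) : Fin n → ℝ := intVec (discretize x)

/-- The image of a set `Γ` under the discretization `P̂` of the matrix `P`. -/
def PhatImg {n : ℕ} (P : Matrix (Fin n) (Fin n) ℝ) (Γ : Set (Fin n → ℝ)) :
    Set (Fin n → ℝ) :=
  (fun x => discretizeR (P.mulVec x)) '' Γ

/-- The uniform `R`-density `D_R^+`. Balls are sup-norm balls. -/
def DRplus {n : ℕ} (Γ : Set (Fin n → ℝ)) (R : ℝ) : ℝ :=
  ⨆ x : Fin n → ℝ,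
    ((Metric.ball x R ∩ Γ).ncard : ℝ) / ((Metric.ball x R ∩ intPoints n).ncard : ℝ)

/-- Relatively dense with parameter `R₀`. -/
def RelativelyDenseWith {n : ℕ} (Γ : Set (Fin n → ℝ)) (R₀ : ℝ) : Prop :=
  ∀ x : Fin n → ℝ, ∀ r, R₀ ≤ r → (Metric.ball x r ∩ Γ).Nonempty

def RelativelyDense {n : ℕ} (Γ : Set (Fin n → ℝ)) : Prop :=
  ∃ R₀ > 0, RelativelyDenseWith Γ R₀

/-- Uniformly discrete with parameter `r₀`. -/
def UniformlyDiscreteWith {n : ℕ} (Γ : Set (Fin n → ℝ)) (r₀ : ℝ) : Prop :=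
  ∀ x : Fin n → ℝ, ∀ r, 0 < r → r ≤ r₀ → (Metric.ball x r ∩ Γ).Subsingleton

def UniformlyDiscrete {n : ℕ} (Γ : Set (Fin n → ℝ)) : Prop :=
  ∃ r₀ > 0, UniformlyDiscreteWith Γ r₀

def Delone {n : ℕ} (Γ : Set (Fin n → ℝ)) : Prop :=
  RelativelyDense Γ ∧ UniformlyDiscrete Γ

/-- The translateSet `Γ + v`. -/
def translateSet {n : ℕ} (Γ : Set (Fin n → ℝ)) (v : Fin n → ℝ) : Set (Fin n → ℝ) :=
  (· + v) '' Γ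

/-- `N` is a set of `ε`-translations of `Γ` with radius `Rε`. -/
def IsEpsTranslationSet {n : ℕ} (Γ : Set (Fin n → ℝ)) (ε Rε : ℝ)
    (N : Set (Fin n → ℝ)) : Prop :=
  N ⊆ intPoints n ∧ RelativelyDense N ∧
    ∀ R, Rε ≤ R → ∀ v ∈ N, DRplus (symmDiff (translateSet Γ v) Γ) R < ε

/-- Almost periodic pattern. -/
def AlmostPeriodicPattern {n : ℕ} (Γ : Set (Fin n → ℝ)) : Prop :=
  Γ ⊆ intPoints n ∧ Delone Γ ∧
    ∀ ε > 0, ∃ Rε > 0, ∃ N : Set (Fin n → ℝ), IsEpsTranslationSet Γ ε Rε N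

/-- `Γ` has uniform density `D`. -/
def HasUnifDensity {n : ℕ} (Γ : Set (Fin n → ℝ)) (D : ℝ) : Prop :=
  ∀ ε > 0, ∃ R₀ > 0, ∀ R, R₀ ≤ R → ∀ x : Fin n → ℝ,
    |((Metric.ball x R ∩ Γ).ncard : ℝ) / ((Metric.ball x R ∩ intPoints n).ncard : ℝ) - D| ≤ ε

/-- `Γ ∩ (Γ - v)`, the set of `x ∈ Γ` with `x + v ∈ Γ`. -/
def diffSet {n : ℕ} (Γ : Set (Fin n → ℝ)) (v : Fin n → ℝ) : Set (Fin n → ℝ) :=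
  Γ ∩ {x | x + v ∈ Γ}

/-- `E` is equidistributed modulo `ℤ^n`: averages of continuous `ℤ^n`-periodic functions over
`E ∩ B_R` converge to the Haar integral. -/
def EquidistributedModZn {n : ℕ} (E : Set (Fin n → ℝ)) : Prop :=
  ∀ f : (Fin n → ℝ) → ℝ, Continuous f →
    (∀ (x : Fin n → ℝ) (v : Fin n → ℤ), f (x + intVec v) = f x) →
    Filter.Tendsto (fun R : ℝ =>
        (∑ᶠ x ∈ E ∩ Metric.ball (0 : Fin n → ℝ) R, f x) /
          ((E ∩ Metric.ball (0 : Fin n → ℝ) R).ncard : ℝ))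
      Filter.atTop
      (nhds (∫ x in Set.pi Set.univ (fun _ : Fin n => Set.Ico (0:ℝ) 1), f x))

/-- `P` is totally irrational: `P(ℤ^n)` is equidistributed modulo `ℤ^n`. -/
def TotallyIrrational {n : ℕ} (P : Matrix (Fin n) (Fin n) ℝ) : Prop :=
  EquidistributedModZn (P.mulVec '' intPoints n)

/-- Rate of injectivity in time 1. -/
def tauOne {n : ℕ} (P : Matrix (Fin n) (Fin n) ℝ) : ℝ :=
  Filter.limsup (fun R : ℝ =>
    ((PhatImg P (intPoints n) ∩ Metric.ball (0 : Fin n → ℝ) R).ncard : ℝ) /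
      ((intPoints n ∩ Metric.ball (0 : Fin n → ℝ) R).ncard : ℝ)) Filter.atTop

/-- The successive images `(P̂_k ∘ ⋯ ∘ P̂_1)(Γ)`. -/
def seqImg {n : ℕ} (P : ℕ → Matrix (Fin n) (Fin n) ℝ) :
    ℕ → Set (Fin n → ℝ) → Set (Fin n → ℝ)
  | 0, Γ => Γ
  | k + 1, Γ => PhatImg (P (k + 1)) (seqImg P k Γ)

/-- Rate of injectivity in time `k` of the sequence `(P_k)`. -/
def tauK {n : ℕ} (P : ℕ → Matrix (Fin n) (Fin n) ℝ) (k : ℕ) : ℝ :=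
  Filter.limsup (fun R : ℝ =>
    ((seqImg P k (intPoints n) ∩ Metric.ball (0 : Fin n → ℝ) R).ncard : ℝ) /
      ((intPoints n ∩ Metric.ball (0 : Fin n → ℝ) R).ncard : ℝ)) Filter.atTop

/-- A fixed norm on `M_n(ℝ)`: the sup of absolute values of the entries. -/
def matNorm {n : ℕ} (A : Matrix (Fin n) (Fin n) ℝ) : ℝ :=
  ⨆ p : Fin n × Fin n, |A p.1 p.2|


/-- The function `φ_u`, a "weighted projection" of `u` on `ℤ^n`. -/
def phiFn {n : ℕ} (u : Fin n → ℝ) (v : Fin n → ℤ) : ℝ :=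
  if ‖u - intVec v‖ < 1 then ∏ i, (1 - |u i - (v i : ℝ)|) else 0

/-- `I_ℚ(A)`: the set of indices `i` such that all entries of the `i`-th row of `A`
are rational. -/
def IQ {n : ℕ} (A : Matrix (Fin n) (Fin n) ℝ) : Set (Fin n) :=
  {i | ∀ j, ∃ q : ℚ, A i j = (q : ℝ)}

/-- A sequence of matrices all lying in `O_n(ℝ)`. -/
def IsOnSeq {n : ℕ} (P : ℕ → Matrix (Fin n) (Fin n) ℝ) : Prop :=
  ∀ k, P k ∈ Matrix.orthogonalGroup (Fin n) ℝ

/-- The `ℓ^∞` distance on sequences of matrices. -/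
def seqDist {n : ℕ} (P Q : ℕ → Matrix (Fin n) (Fin n) ℝ) : ℝ :=
  ⨆ k : ℕ, matNorm (P k - Q k)

/-- Open subsets of `ℓ^∞(O_n(ℝ))`. -/
def IsOpenSeq {n : ℕ} (U : Set {P : ℕ → Matrix (Fin n) (Fin n) ℝ // IsOnSeq P}) : Prop :=
  ∀ P ∈ U, ∃ δ > 0, ∀ Q : {P : ℕ → Matrix (Fin n) (Fin n) ℝ // IsOnSeq P},
    seqDist P.1 Q.1 < δ → Q ∈ U

/-- Dense subsets of `ℓ^∞(O_n(ℝ))`. -/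
def IsDenseSeq {n : ℕ} (U : Set {P : ℕ → Matrix (Fin n) (Fin n) ℝ // IsOnSeq P}) : Prop :=
  ∀ P : {P : ℕ → Matrix (Fin n) (Fin n) ℝ // IsOnSeq P}, ∀ δ > 0,
    ∃ Q ∈ U, seqDist P.1 Q.1 < δ

lemma translateSet_subset_intPoints {n : ℕ} {Γ : Set (Fin n → ℝ)} (hΓ : Γ ⊆ intPoints n)
    {v : Fin n → ℝ} (hv : v ∈ intPoints n) : translateSet Γ v ⊆ intPoints n := by
  rintro _ ⟨x, hx, rfl⟩
  obtain ⟨a, rfl⟩ := hΓ hx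
  obtain ⟨b, rfl⟩ := hv
  exact ⟨a + b, by ext i; simp [intVec]⟩

lemma neg_mem_intPoints {n : ℕ} {v : Fin n → ℝ} (hv : v ∈ intPoints n) : -v ∈ intPoints n := by
  obtain ⟨b, rfl⟩ := hv
  exact ⟨-b, by ext i; simp [intVec]⟩

lemma mem_translateSet {n : ℕ} {Γ : Set (Fin n → ℝ)} {v x : Fin n → ℝ} :
    x ∈ translateSet Γ v ↔ x - v ∈ Γ := by
  simp [translateSet, ← sub_eq_add_neg]

lemma translateSet_intPoints {n : ℕ} {v : Fin n → ℝ} (hv : v ∈ intPoints n) :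
    translateSet (intPoints n) v = intPoints n := by
  refine (translateSet_subset_intPoints subset_rfl hv).antisymm fun x hx => ?_
  rw [mem_translateSet]
  exact translateSet_subset_intPoints subset_rfl (neg_mem_intPoints hv)
    ⟨x, hx, (sub_eq_add_neg x v).symm⟩

lemma finite_ball_inter_intPoints {n : ℕ} (x : Fin n → ℝ) (R : ℝ) :
    (Metric.ball x R ∩ intPoints n).Finite := by
  refine ((Set.finite_Icc (fun i => ⌊x i - R⌋) (fun i => ⌈x i + R⌉)).image
    (intVec (n := n))).subset ?_
  rintro _ ⟨hy, a, rfl⟩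
  have h (i) : |(a i : ℝ) - x i| < R :=
    (norm_le_pi_norm (intVec a - x) i).trans_lt (mem_ball_iff_norm.1 hy)
  refine ⟨a, ⟨fun i => ?_, fun i => ?_⟩, rfl⟩
  · have : (⌊x i - R⌋ : ℝ) ≤ a i := (Int.floor_le _).trans (by linarith [(abs_lt.1 (h i)).1])
    exact_mod_cast this
  · have : (a i : ℝ) ≤ ⌈x i + R⌉ := le_trans (by linarith [(abs_lt.1 (h i)).2]) (Int.le_ceil _)
    exact_mod_cast this

lemma bddAbove_density {n : ℕ} {E : Set (Fin n → ℝ)} (hE : E ⊆ intPoints n) (R : ℝ) :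
    BddAbove (Set.range fun x : Fin n → ℝ =>
      ((Metric.ball x R ∩ E).ncard : ℝ) / ((Metric.ball x R ∩ intPoints n).ncard : ℝ)) := by
  refine ⟨1, ?_⟩
  rintro _ ⟨x, rfl⟩
  refine div_le_one_of_le₀ ?_ (Nat.cast_nonneg _)
  exact_mod_cast Set.ncard_le_ncard (Set.inter_subset_inter_right _ hE)
    (finite_ball_inter_intPoints x R)

lemma ncard_ball_inter_translateSet {n : ℕ} (E : Set (Fin n → ℝ)) (v x : Fin n → ℝ) (R : ℝ) :
    (Metric.ball x R ∩ translateSet E v).ncard = (Metric.ball (x - v) R ∩ E).ncard := by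
  rw [← Set.ncard_image_of_injective (Metric.ball (x - v) R ∩ E) (add_left_injective v)]
  congr 1
  ext y
  simp [translateSet, ← sub_eq_add_neg]

lemma DRplus_translateSet {n : ℕ} (E : Set (Fin n → ℝ)) {v : Fin n → ℝ} (hv : v ∈ intPoints n)
    (R : ℝ) : DRplus (translateSet E v) R = DRplus E R := by
  unfold DRplus
  rw [← (Equiv.subRight v).iSup_comp (g := fun x : Fin n → ℝ =>
    ((Metric.ball x R ∩ E).ncard : ℝ) / ((Metric.ball x R ∩ intPoints n).ncard : ℝ))]
  congr 1
  ext x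
  rw [ncard_ball_inter_translateSet]
  conv_lhs => rw [← translateSet_intPoints hv, ncard_ball_inter_translateSet]
  rfl

lemma DRplus_le_add {n : ℕ} {E F G : Set (Fin n → ℝ)} (hF : F ⊆ intPoints n)
    (hG : G ⊆ intPoints n) (h : E ⊆ F ∪ G) (R : ℝ) :
    DRplus E R ≤ DRplus F R + DRplus G R := by
  refine ciSup_le fun x => ?_
  refine le_trans ?_ (add_le_add (le_ciSup (bddAbove_density hF R) x)
    (le_ciSup (bddAbove_density hG R) x))
  rw [← add_div]
  gcongr
  have hfin := finite_ball_inter_intPoints x R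
  have h₁ : (Metric.ball x R ∩ E).ncard ≤
      ((Metric.ball x R ∩ F) ∪ (Metric.ball x R ∩ G)).ncard := by
    rw [← Set.inter_union_distrib_left]
    exact Set.ncard_le_ncard (Set.inter_subset_inter_right _ h)
      (hfin.subset (Set.inter_subset_inter_right _ (Set.union_subset hF hG)))
  exact_mod_cast h₁.trans (Set.ncard_union_le _ _)

/-- The difference of two translations moves `Γ` no more than both of them do together. -/
lemma DRplus_symmDiff_sub_le {n : ℕ} {Γ : Set (Fin n → ℝ)} (hΓ : Γ ⊆ intPoints n)
    {v w : Fin n → ℝ} (hv : v ∈ intPoints n) (hw : w ∈ intPoints n) (R : ℝ) :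
    DRplus (symmDiff (translateSet Γ (v - w)) Γ) R ≤
      DRplus (symmDiff (translateSet Γ v) Γ) R + DRplus (symmDiff (translateSet Γ w) Γ) R := by
  have hsub {u : Fin n → ℝ} (hu : u ∈ intPoints n) :
      symmDiff (translateSet Γ u) Γ ⊆ intPoints n :=
    Set.symmDiff_subset_union.trans (Set.union_subset (translateSet_subset_intPoints hΓ hu) hΓ)
  rw [← DRplus_translateSet (symmDiff (translateSet Γ (v - w)) Γ) hw]
  refine DRplus_le_add (hsub hv) (hsub hw) (fun x => ?_) R
  simp only [Set.mem_union, Set.mem_symmDiff, mem_translateSet, sub_sub, add_sub_cancel]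
  tauto

/-- The rational entries of a real matrix have a common denominator. -/
lemma exists_common_denominator {n : ℕ} (A : Matrix (Fin n) (Fin n) ℝ) :
    ∃ Q : ℕ, 0 < Q ∧ ∀ i ∈ IQ A, ∀ j, ∃ m : ℤ, A i j * Q = m := by
  have h (i j : Fin n) : ∃ d : ℕ, 0 < d ∧ ((∃ q : ℚ, A i j = q) → ∃ m : ℤ, A i j * d = m) := by
    by_cases hq : ∃ q : ℚ, A i j = q
    · obtain ⟨q, hq⟩ := hq
      refine ⟨q.den, q.den_pos, fun _ => ⟨q.num, ?_⟩⟩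
      rw [hq]
      exact_mod_cast Rat.mul_den_eq_num q
    · exact ⟨1, one_pos, fun h => absurd h hq⟩
  choose d hd hm using h
  refine ⟨∏ i, ∏ j, d i j, Finset.prod_pos fun i _ => Finset.prod_pos fun j _ => hd i j,
    fun i hi j => ?_⟩
  obtain ⟨m, hm⟩ := hm i j (hi j)
  obtain ⟨k, hk⟩ : d i j ∣ ∏ i, ∏ j, d i j :=
    (Finset.dvd_prod_of_mem _ (Finset.mem_univ j)).trans
      (Finset.dvd_prod_of_mem (fun i => ∏ j, d i j) (Finset.mem_univ i))
  exact ⟨m * k, by rw [hk]; push_cast; rw [← mul_assoc, hm]⟩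

/-- Subtracting from each point of a relatively dense set one of finitely many vectors leaves a
relatively dense set. -/
lemma RelativelyDense.image_sub {n : ℕ} {N : Set (Fin n → ℝ)} (hN : RelativelyDense N)
    {f : (Fin n → ℝ) → (Fin n → ℝ)} (hf : (f '' N).Finite) :
    RelativelyDense ((fun v => v - f v) '' N) := by
  obtain ⟨R₀, hR₀, hN⟩ := hN
  obtain ⟨M, hM, hfM⟩ := hf.isBounded.exists_pos_norm_le
  refine ⟨R₀ + M, by positivity, fun x r hr => ?_⟩
  obtain ⟨v, hv, hvN⟩ := hN x R₀ le_rfl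
  refine ⟨v - f v, ?_, v, hvN, rfl⟩
  rw [mem_ball_iff_norm] at hv ⊢
  calc ‖v - f v - x‖ = ‖(v - x) - f v‖ := by rw [sub_right_comm]
    _ ≤ ‖v - x‖ + ‖f v‖ := norm_sub_le _ _
    _ < r := by linarith [hfM _ ⟨v, hvN, rfl⟩]

/-- Points of a set can be replaced by representatives in the set having the same value under a
finite-valued map, using only finitely many representatives. -/
lemma exists_finite_representatives {α β : Type*} [Finite β] (N : Set α) (c : α → β) :
    ∃ f : α → α, (f '' N).Finite ∧ ∀ v ∈ N, f v ∈ N ∧ c (f v) = c v := by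
  obtain ⟨T, hTN, hT⟩ := Set.exists_subset_bijOn N c
  have h (v : α) : ∃ w, v ∈ N → w ∈ T ∧ c w = c v := by
    by_cases hv : v ∈ N
    · obtain ⟨w, hw, hwv⟩ := hT.surjOn ⟨v, hv, rfl⟩
      exact ⟨w, fun _ => ⟨hw, hwv⟩⟩
    · exact ⟨v, fun h => absurd h hv⟩
  choose f hf using h
  refine ⟨f, ?_, fun v hv => ⟨hTN (hf v hv).1, (hf v hv).2⟩⟩
  refine (Set.Finite.of_finite_image (Set.toFinite (c '' T)) hT.injOn).subset ?_
  rintro _ ⟨v, hv, rfl⟩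
  exact (hf v hv).1

lemma abs_sub_lt_of_floor_mul_fract_eq {K : ℕ} (hK : 0 < K) {a b : ℝ}
    (h : ⌊K * Int.fract a⌋₊ = ⌊K * Int.fract b⌋₊) :
    |a - b - ((⌊a⌋ - ⌊b⌋ : ℤ) : ℝ)| < 1 / K := by
  have hK' : (0 : ℝ) < K := by exact_mod_cast hK
  have hnn (t : ℝ) : 0 ≤ K * Int.fract t := mul_nonneg hK'.le (Int.fract_nonneg t)
  have ha := Nat.floor_le (hnn a)
  have ha' := Nat.lt_floor_add_one (K * Int.fract a)
  have hb := Nat.floor_le (hnn b)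
  have hb' := Nat.lt_floor_add_one (K * Int.fract b)
  rw [h] at ha ha'
  have hab : a - b - ((⌊a⌋ - ⌊b⌋ : ℤ) : ℝ) = Int.fract a - Int.fract b := by
    rw [Int.fract, Int.fract]; push_cast; ring
  rw [hab, lt_div_iff₀ hK', ← abs_of_pos hK', ← abs_mul, abs_lt]
  constructor <;> nlinarith

/-- There is a finite colouring of `ℝ^n` for which the difference of any two integer points of the
same colour is mapped by `A` close to `ℤ^n`, and exactly onto integers along the rational rows. -/
lemma exists_finite_coloring {n : ℕ} (A : Matrix (Fin n) (Fin n) ℝ) {δ : ℝ} (hδ : 0 < δ) :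
    ∃ (β : Type) (_ : Finite β) (c : (Fin n → ℝ) → β),
      ∀ v ∈ intPoints n, ∀ w ∈ intPoints n, c w = c v →
        (∃ u : Fin n → ℤ, ‖A.mulVec (v - w) - intVec u‖ < δ) ∧
        ∀ i ∈ IQ A, ∃ m : ℤ, A.mulVec (v - w) i = (m : ℝ) := by
  obtain ⟨Q, hQ, hAQ⟩ := exists_common_denominator A
  obtain ⟨k, hk⟩ := exists_nat_one_div_lt hδ
  have : NeZero Q := ⟨hQ.ne'⟩
  have hlt (t : ℝ) : ⌊((k + 1 : ℕ) : ℝ) * Int.fract t⌋₊ < k + 1 := by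
    have hk0 : (0 : ℝ) < ((k + 1 : ℕ) : ℝ) := by positivity
    rw [Nat.floor_lt (mul_nonneg hk0.le (Int.fract_nonneg t))]
    nlinarith [Int.fract_lt_one t]
  refine ⟨(Fin n → ZMod Q) × (Fin n → Fin (k + 1)), inferInstance,
    fun v => (fun j => (⌊v j⌋ : ZMod Q), fun i => ⟨_, hlt (A.mulVec v i)⟩), ?_⟩
  rintro _ ⟨a, rfl⟩ _ ⟨b, rfl⟩ hab
  simp only [Prod.mk.injEq, funext_iff, Fin.mk.injEq, intVec, Int.floor_intCast] at hab
  obtain ⟨hmod, hfloor⟩ := hab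
  constructor
  · refine ⟨fun i => ⌊A.mulVec (intVec a) i⌋ - ⌊A.mulVec (intVec b) i⌋,
      (pi_norm_lt_iff hδ).2 fun i => ?_⟩
    rw [Matrix.mulVec_sub]
    refine (abs_sub_lt_of_floor_mul_fract_eq k.succ_pos (hfloor i).symm).trans ?_
    exact_mod_cast hk
  · intro i hi
    have hdvd (j : Fin n) : (Q : ℤ) ∣ a j - b j :=
      (ZMod.intCast_eq_intCast_iff_dvd_sub (b j) (a j) Q).1 (hmod j)
    choose l hl using hdvd
    choose m hm using hAQ i hi
    refine ⟨∑ j, m j * l j, ?_⟩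
    simp only [Matrix.mulVec, dotProduct, Int.cast_sum, Int.cast_mul, ← hm]
    refine Finset.sum_congr rfl fun j _ => ?_
    have : (a j : ℝ) - b j = Q * l j := by exact_mod_cast hl j
    simp [intVec, this, mul_assoc]

/-- Given an almost periodic pattern `Γ`, `ε, δ > 0` and `A ∈ GL_n(ℝ)`, there is a relatively
dense set of `ε`-translations `v` of `Γ` such that `A v` is `δ`-close to `ℤ^n`, with
`(A v)_i ∈ ℤ` for every `i ∈ I_ℚ(A)`. -/
theorem statement16 {n : ℕ} (Γ : Set (Fin n → ℝ)) (hΓ : AlmostPeriodicPattern Γ)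
    (ε δ : ℝ) (hε : 0 < ε) (hδ : 0 < δ)
    (A : Matrix (Fin n) (Fin n) ℝ) (hA : IsUnit A.det) :
    ∃ Rεδ > 0, ∃ N : Set (Fin n → ℝ),
      IsEpsTranslationSet Γ ε Rεδ N ∧
      (∀ v ∈ N, ∃ w : Fin n → ℤ, ‖A.mulVec v - intVec w‖ < δ) ∧
      (∀ v ∈ N, ∀ i ∈ IQ A, ∃ m : ℤ, A.mulVec v i = (m : ℝ)) := by
  obtain ⟨hΓint, -, hΓap⟩ := hΓ
  obtain ⟨R, hR, N, hNint, hNdense, hN⟩ := hΓap (ε / 2) (half_pos hε)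
  obtain ⟨β, _, c, hc⟩ := exists_finite_coloring A hδ
  obtain ⟨f, hfin, hf⟩ := exists_finite_representatives N c
  refine ⟨R, hR, (fun v => v - f v) '' N, ⟨?_, hNdense.image_sub hfin, ?_⟩, ?_, ?_⟩
  · rintro _ ⟨v, hv, rfl⟩
    exact translateSet_subset_intPoints subset_rfl (neg_mem_intPoints (hNint (hf v hv).1))
      ⟨v, hNint hv, (sub_eq_add_neg v (f v)).symm⟩
  · rintro r hr _ ⟨v, hv, rfl⟩
    linarith [DRplus_symmDiff_sub_le hΓint (hNint hv) (hNint (hf v hv).1) r, hN r hr v hv,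
      hN r hr _ (hf v hv).1]
  · rintro _ ⟨v, hv, rfl⟩
    exact (hc v (hNint hv) _ (hNint (hf v hv).1) (hf v hv).2).1
  · rintro _ ⟨v, hv, rfl⟩
    exact (hc v (hNint hv) _ (hNint (hf v hv).1) (hf v hv).2).2

end
end

section
/- Let ε > 0 and A ∈ GL_n(ℝ). Then there exist δ > 0 and R_0 > 0 such that for every w ∈ ℝ^n with ‖w‖_∞ < δ and w_i = 0 for every i ∈ I_ℚ(A), and for every R ≥ R_0, one has D_R^+( π(A ℤ^n) Δ π(A ℤ^n + w) ) ≤ ε. -/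
open Filter MeasureTheory
open scoped BigOperators

noncomputable section

/-- The integer points of the open sup-norm ball of centre `x` and radius `ρ`. -/
def intBox {n : ℕ} (x : Fin n → ℝ) (ρ : ℝ) : Finset (Fin n → ℤ) :=
  Fintype.piFinset fun i => Finset.Ioo ⌊x i - ρ⌋ ⌈x i + ρ⌉

theorem mem_intBox {n : ℕ} {x : Fin n → ℝ} {ρ : ℝ} {v : Fin n → ℤ} :
    v ∈ intBox x ρ ↔ ∀ i, |(v i : ℝ) - x i| < ρ := by
  simp only [intBox, Fintype.mem_piFinset, Finset.mem_Ioo, Int.floor_lt, Int.lt_ceil, abs_lt]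
  refine forall_congr' fun i => ⟨fun h => ⟨?_, ?_⟩, fun h => ⟨?_, ?_⟩⟩ <;> linarith [h.1, h.2]

theorem card_intBox_le {n : ℕ} (x : Fin n → ℝ) {ρ : ℝ} (hρ : 0 ≤ ρ) :
    ((intBox x ρ).card : ℝ) ≤ (2 * ρ + 1) ^ n := by
  rw [intBox, Fintype.card_piFinset, Nat.cast_prod]
  calc _ ≤ ∏ _i : Fin n, (2 * ρ + 1) := by
        refine Finset.prod_le_prod (fun _ _ => Nat.cast_nonneg _) fun i _ => ?_
        rw [Int.card_Ioo, ← Int.cast_natCast, Int.toNat_eq_max]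
        push_cast
        refine max_le ?_ (by linarith)
        linarith [Int.ceil_lt_add_one (x i + ρ), Int.lt_floor_add_one (x i - ρ)]
    _ = _ := by simp

theorem le_card_intBox {n : ℕ} (x : Fin n → ℝ) {ρ : ℝ} (hρ : 1 ≤ ρ) :
    ρ ^ n ≤ ((intBox x ρ).card : ℝ) := by
  rw [intBox, Fintype.card_piFinset, Nat.cast_prod]
  calc ρ ^ n = ∏ _i : Fin n, ρ := by simp
    _ ≤ _ := by
        refine Finset.prod_le_prod (fun _ _ => by linarith) fun i _ => ?_
        rw [Int.card_Ioo, ← Int.cast_natCast, Int.toNat_eq_max]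
        push_cast
        refine le_max_of_le_left ?_
        linarith [Int.le_ceil (x i + ρ), Int.floor_le (x i - ρ)]

theorem intVec_injective {n : ℕ} : Function.Injective (intVec (n := n)) := fun u v h => by
  ext i
  exact Int.cast_injective (α := ℝ) (congrFun h i)

theorem intVec_mem_ball {n : ℕ} {x : Fin n → ℝ} {ρ : ℝ} (hρ : 0 < ρ) {v : Fin n → ℤ} :
    intVec v ∈ Metric.ball x ρ ↔ ∀ i, |(v i : ℝ) - x i| < ρ := by
  rw [Metric.mem_ball, dist_pi_lt_iff hρ]
  rfl

theorem ncard_ball_inter_intPoints {n : ℕ} (x : Fin n → ℝ) {ρ : ℝ} (hρ : 0 < ρ) :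
    (Metric.ball x ρ ∩ intPoints n).ncard = (intBox x ρ).card := by
  rw [← Set.ncard_coe_finset, ← Set.ncard_image_of_injective _ intVec_injective]
  congr 1
  ext y
  constructor
  · rintro ⟨hy, v, rfl⟩
    exact ⟨v, mem_intBox.2 ((intVec_mem_ball hρ).1 hy), rfl⟩
  · rintro ⟨v, hv, rfl⟩
    exact ⟨(intVec_mem_ball hρ).2 (mem_intBox.1 hv), v, rfl⟩

theorem abs_roundHalf_sub_le (t : ℝ) : |(roundHalf t : ℝ) - t| ≤ 1 / 2 := by
  have h₁ := Int.le_ceil (t - 1 / 2)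
  have h₂ := Int.ceil_lt_add_one (t - 1 / 2)
  rw [roundHalf, abs_le]
  constructor <;> linarith

/-- If a perturbation smaller than `δ` changes the rounding of `t`, then `t` is `δ`-close to a
half-integer. -/
theorem exists_abs_sub_half_lt_of_roundHalf_ne {t s δ : ℝ} (hs : |s| < δ)
    (h : roundHalf t ≠ roundHalf (t + s)) : ∃ m : ℤ, |t - 1 / 2 - m| < δ := by
  obtain ⟨hs₁, hs₂⟩ := abs_lt.1 hs
  unfold roundHalf at h
  rcases lt_or_gt_of_ne h with h | h
  · refine ⟨⌈t - 1 / 2⌉, ?_⟩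
    have h₁ := Int.le_ceil (t - 1 / 2)
    have h₂ := Int.lt_ceil.1 h
    rw [abs_lt]
    constructor <;> linarith
  · refine ⟨⌈t + s - 1 / 2⌉, ?_⟩
    have h₁ := Int.le_ceil (t + s - 1 / 2)
    have h₂ := Int.lt_ceil.1 h
    rw [abs_lt]
    constructor <;> linarith

theorem intVec_sub {n : ℕ} (u v : Fin n → ℤ) : intVec (u - v) = intVec u - intVec v := by
  ext i
  simp [intVec]

theorem mulVec_intVec_add_single {n : ℕ} (A : Matrix (Fin n) (Fin n) ℝ) (v : Fin n → ℤ)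
    (i j : Fin n) (k : ℤ) :
    A.mulVec (intVec (v + Pi.single j k)) i = A.mulVec (intVec v) i + k * A i j := by
  have h : intVec (v + Pi.single j k) = intVec v + Pi.single j (k : ℝ) := by
    ext l
    by_cases hl : l = j
    · subst hl
      simp [intVec]
    · simp [intVec, hl]
  rw [h, Matrix.mulVec_add, Pi.add_apply, Matrix.mulVec_single]
  simp [mul_comm]

/-- Only finitely many integer vectors have a small image under an invertible matrix. -/
theorem finite_abs_mulVec_intVec_le {n : ℕ} {A : Matrix (Fin n) (Fin n) ℝ} (hA : IsUnit A.det)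
    (r : ℝ) : {u : Fin n → ℤ | ∀ i, |A.mulVec (intVec u) i| ≤ r}.Finite := by
  refine (Set.finite_Icc (fun i => ⌊-(∑ j, |A⁻¹ i j| * r)⌋)
    (fun i => ⌈∑ j, |A⁻¹ i j| * r⌉)).subset fun u hu => ?_
  have key (i : Fin n) : |(u i : ℝ)| ≤ ∑ j, |A⁻¹ i j| * r := by
    have h : (u i : ℝ) = ∑ j, A⁻¹ i j * A.mulVec (intVec u) j := by
      have h' : A⁻¹.mulVec (A.mulVec (intVec u)) = intVec u := by
        rw [Matrix.mulVec_mulVec, Matrix.nonsing_inv_mul _ hA, Matrix.one_mulVec]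
      exact (congrFun h' i).symm
    rw [h]
    refine (Finset.abs_sum_le_sum_abs _ _).trans (Finset.sum_le_sum fun j _ => ?_)
    rw [abs_mul]
    exact mul_le_mul_of_nonneg_left (hu j) (abs_nonneg _)
  constructor
  · intro i
    have h : (⌊-(∑ j, |A⁻¹ i j| * r)⌋ : ℝ) ≤ u i :=
      (Int.floor_le _).trans (abs_le.1 (key i)).1
    exact_mod_cast h
  · intro i
    have h : (u i : ℝ) ≤ ⌈∑ j, |A⁻¹ i j| * r⌉ := (abs_le.1 (key i)).2.trans (Int.le_ceil _)
    exact_mod_cast h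

/-- The number of lattice points in a ball is controlled by the number of integer points of a
slightly larger ball. -/
theorem exists_ncard_lattice_ball_le {n : ℕ} {A : Matrix (Fin n) (Fin n) ℝ}
    (hA : IsUnit A.det) :
    ∃ K : ℕ, ∀ (x : Fin n → ℝ) (ρ : ℝ),
      {v : Fin n → ℤ | ∀ i, |A.mulVec (intVec v) i - x i| < ρ}.Finite ∧
      {v : Fin n → ℤ | ∀ i, |A.mulVec (intVec v) i - x i| < ρ}.ncard ≤
        K * (intBox x (ρ + 1)).card := by
  classical
  set U := {u : Fin n → ℤ | ∀ i, |A.mulVec (intVec u) i| ≤ 1}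
  have hU : U.Finite := finite_abs_mulVec_intVec_le hA 1
  let f : (Fin n → ℤ) → (Fin n → ℤ) := fun v => discretize (A.mulVec (intVec v))
  have fiber (v₀ : Fin n → ℤ) : f ⁻¹' {f v₀} ⊆ (· + v₀) '' U := by
    intro v hv
    refine ⟨v - v₀, fun i => ?_, sub_add_cancel _ _⟩
    have e : roundHalf (A.mulVec (intVec v) i) = roundHalf (A.mulVec (intVec v₀) i) :=
      congrFun hv i
    have h₁ := abs_le.1 (abs_roundHalf_sub_le (A.mulVec (intVec v) i))
    have h₂ := abs_le.1 (abs_roundHalf_sub_le (A.mulVec (intVec v₀) i))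
    rw [e] at h₁
    rw [intVec_sub, Matrix.mulVec_sub, Pi.sub_apply, abs_le]
    constructor <;> linarith [h₁.1, h₁.2, h₂.1, h₂.2]
  have fiber_finite (y : Fin n → ℤ) : (f ⁻¹' {y}).Finite := by
    rcases (f ⁻¹' {y}).eq_empty_or_nonempty with h | ⟨v₀, rfl⟩
    · simp [h]
    · exact (hU.image _).subset (fiber v₀)
  have fiber_card (y : Fin n → ℤ) : (f ⁻¹' {y}).ncard ≤ U.ncard := by
    rcases (f ⁻¹' {y}).eq_empty_or_nonempty with h | ⟨v₀, rfl⟩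
    · simp [h]
    · exact (Set.ncard_le_ncard (fiber v₀) (hU.image _)).trans (Set.ncard_image_le hU)
  refine ⟨U.ncard, fun x ρ => ?_⟩
  set T := {v : Fin n → ℤ | ∀ i, |A.mulVec (intVec v) i - x i| < ρ}
  have maps (v : Fin n → ℤ) (hv : v ∈ T) : f v ∈ intBox x (ρ + 1) := by
    refine mem_intBox.2 fun i => ?_
    have h₁ := abs_le.1 (abs_roundHalf_sub_le (A.mulVec (intVec v) i))
    have h₂ := abs_lt.1 (hv i)
    change |(roundHalf (A.mulVec (intVec v) i) : ℝ) - x i| < ρ + 1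
    rw [abs_lt]
    constructor <;> linarith [h₁.1, h₁.2, h₂.1, h₂.2]
  have hT : T.Finite :=
    ((intBox x (ρ + 1)).finite_toSet.preimage' fun y _ => fiber_finite y).subset maps
  refine ⟨hT, ?_⟩
  rw [Set.ncard_eq_toFinset_card T hT]
  refine Finset.card_le_mul_card_image_of_maps_to (f := f)
    (fun v hv => maps v (hT.mem_toFinset.1 hv)) _ fun y _ => ?_
  rw [← Set.ncard_coe_finset]
  refine (Set.ncard_le_ncard (fun v hv => ?_) (fiber_finite y)).trans (fiber_card y)
  exact (Finset.mem_filter.1 (Finset.mem_coe.1 hv)).2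

/-- The first multiples of an irrational number stay away from the integers. -/
theorem eventually_le_abs_mul_sub_int {a : ℝ} (ha : Irrational a) (M : ℕ) :
    ∀ᶠ δ in nhdsWithin (0 : ℝ) (Set.Ioi 0),
      ∀ d : ℤ, d ≠ 0 → |d| < M → ∀ m : ℤ, 2 * δ ≤ |d * a - m| := by
  have h : ∀ᶠ δ in nhdsWithin (0 : ℝ) (Set.Ioi 0), ∀ d ∈ Set.Ioo (-(M : ℤ)) M,
      d ≠ 0 → ∀ m : ℤ, 2 * δ ≤ |d * a - m| := by
    refine (Filter.eventually_all_finite (Set.finite_Ioo _ _)).2 fun d _ => ?_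
    by_cases hd : d = 0
    · simp [hd]
    have hpos : 0 < |d * a - round (d * a)| := by
      refine abs_pos.2 fun h0 => (ha.intCast_mul hd).ne_int (round (d * a)) ?_
      linarith
    filter_upwards [Ioo_mem_nhdsGT (half_pos hpos)] with δ hδ _ m
    linarith [hδ.2, round_le ((d : ℝ) * a) m]
  filter_upwards [h] with δ hδ d hd hdM
  exact hδ d (abs_lt.1 hdM) hd

/-- If the first `M` nonzero multiples of `A i j` are at distance at least `2 * δ` from the integers, then the
lattice points whose `i`-th coordinate is `δ`-close to a half-integer have disjoint translates
by the first `M` multiples of the `j`-th column. -/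
theorem mul_ncard_near_half_le {n : ℕ} {A : Matrix (Fin n) (Fin n) ℝ} {c : ℝ}
    (hc : ∀ i j, |A i j| ≤ c) {i j : Fin n} {M : ℕ} {δ : ℝ}
    (hδ : ∀ d : ℤ, d ≠ 0 → |d| < M → ∀ m : ℤ, 2 * δ ≤ |d * A i j - m|)
    (x : Fin n → ℝ) (ρ : ℝ)
    (hfin : {v : Fin n → ℤ | ∀ l, |A.mulVec (intVec v) l - x l| < ρ + M * c}.Finite) :
    M * {v : Fin n → ℤ | (∀ l, |A.mulVec (intVec v) l - x l| < ρ) ∧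
        ∃ m : ℤ, |A.mulVec (intVec v) i - 1 / 2 - m| < δ}.ncard ≤
      {v : Fin n → ℤ | ∀ l, |A.mulVec (intVec v) l - x l| < ρ + M * c}.ncard := by
  set S := {v : Fin n → ℤ | (∀ l, |A.mulVec (intVec v) l - x l| < ρ) ∧
    ∃ m : ℤ, |A.mulVec (intVec v) i - 1 / 2 - m| < δ}
  set T := {v : Fin n → ℤ | ∀ l, |A.mulVec (intVec v) l - x l| < ρ + M * c}
  let g : ℕ × (Fin n → ℤ) → (Fin n → ℤ) := fun p => p.2 + Pi.single j (p.1 : ℤ)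
  have maps : ∀ p ∈ (↑(Finset.range M) ×ˢ S : Set (ℕ × (Fin n → ℤ))), g p ∈ T := by
    rintro ⟨k, v⟩ ⟨hk, hv, -⟩ l
    have hk : (k : ℝ) ≤ M := by exact_mod_cast (Finset.mem_range.1 hk).le
    have h₁ : |(k : ℝ) * A l j| ≤ M * c := by
      rw [abs_mul, Nat.abs_cast]
      exact mul_le_mul hk (hc l j) (abs_nonneg _) (Nat.cast_nonneg _)
    have h₂ := abs_le.1 h₁
    have h₃ := abs_lt.1 (hv l)
    have e : A.mulVec (intVec (g (k, v))) l = A.mulVec (intVec v) l + (k : ℤ) * A l j :=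
      mulVec_intVec_add_single A v l j k
    rw [e, Int.cast_natCast, abs_lt]
    constructor <;> linarith [h₂.1, h₂.2, h₃.1, h₃.2]
  have inj : Set.InjOn g (↑(Finset.range M) ×ˢ S) := by
    rintro ⟨k, v⟩ ⟨hk, -, m, hm⟩ ⟨k', v'⟩ ⟨hk', -, m', hm'⟩ h
    have hk : k < M := Finset.mem_range.1 hk
    have hk' : k' < M := Finset.mem_range.1 hk'
    change v + Pi.single j (k : ℤ) = v' + Pi.single j (k' : ℤ) at h
    by_cases hkk : k = k'
    · subst hkk
      rw [add_right_cancel h]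
    · exfalso
      have e := congrArg (fun u => A.mulVec (intVec u) i) h
      simp only [mulVec_intVec_add_single, Int.cast_natCast] at e
      have h₀ := hδ ((k : ℤ) - k') (by omega) (by rw [abs_lt]; omega) (m' - m)
      have h₁ : |(((k : ℤ) - k' : ℤ) : ℝ) * A i j - ((m' - m : ℤ) : ℝ)| < 2 * δ := by
        have a₁ := abs_lt.1 hm
        have a₂ := abs_lt.1 hm'
        push_cast
        rw [abs_lt]
        constructor <;> linarith [a₁.1, a₁.2, a₂.1, a₂.2]
      exact absurd h₀ (not_le.2 h₁)
  have := Set.ncard_le_ncard_of_injOn g maps inj hfin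
  rwa [Set.ncard_prod, Set.ncard_coe_finset, Finset.card_range] at this

/-- The points of a ball at which the two discretized lattices differ come from lattice points
whose rounding is changed by the translation. -/
theorem ncard_ball_inter_symmDiff_le {n : ℕ} (A : Matrix (Fin n) (Fin n) ℝ) {w : Fin n → ℝ}
    (hw : ∀ i, |w i| < 1) (x : Fin n → ℝ) {R : ℝ} (hR : 0 < R)
    (hfin : {v : Fin n → ℤ | ∀ l, |A.mulVec (intVec v) l - x l| < R + 2}.Finite) :
    (Metric.ball x R ∩ symmDiff
      (Set.range fun v : Fin n → ℤ => discretizeR (A.mulVec (intVec v)))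
      (Set.range fun v : Fin n → ℤ => discretizeR (A.mulVec (intVec v) + w))).ncard ≤
    2 * {v : Fin n → ℤ | (∀ l, |A.mulVec (intVec v) l - x l| < R + 2) ∧
      discretize (A.mulVec (intVec v)) ≠ discretize (A.mulVec (intVec v) + w)}.ncard := by
  set S := {v : Fin n → ℤ | (∀ l, |A.mulVec (intVec v) l - x l| < R + 2) ∧
    discretize (A.mulVec (intVec v)) ≠ discretize (A.mulVec (intVec v) + w)}
  have hS : S.Finite := hfin.subset fun v hv => hv.1
  set F : (Fin n → ℤ) → (Fin n → ℝ) := fun v => discretizeR (A.mulVec (intVec v))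
  set G : (Fin n → ℤ) → (Fin n → ℝ) := fun v => discretizeR (A.mulVec (intVec v) + w)
  have sub : Metric.ball x R ∩ symmDiff (Set.range F) (Set.range G) ⊆ F '' S ∪ G '' S := by
    rintro y ⟨hy, ⟨⟨v, rfl⟩, hG⟩ | ⟨⟨v, rfl⟩, hF⟩⟩
    · refine Or.inl ⟨v, ⟨fun l => ?_, fun h => hG ⟨v, congrArg intVec h.symm⟩⟩, rfl⟩
      have h₁ : |(roundHalf (A.mulVec (intVec v) l) : ℝ) - x l| < R :=
        (intVec_mem_ball hR).1 hy l
      have h₂ := abs_le.1 (abs_roundHalf_sub_le (A.mulVec (intVec v) l))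
      rw [abs_lt] at h₁ ⊢
      constructor <;> linarith [h₁.1, h₁.2, h₂.1, h₂.2]
    · refine Or.inr ⟨v, ⟨fun l => ?_, fun h => hF ⟨v, congrArg intVec h⟩⟩, rfl⟩
      have h₁ : |(roundHalf (A.mulVec (intVec v) l + w l) : ℝ) - x l| < R :=
        (intVec_mem_ball hR).1 hy l
      have h₂ := abs_le.1 (abs_roundHalf_sub_le (A.mulVec (intVec v) l + w l))
      have h₃ := abs_lt.1 (hw l)
      rw [abs_lt] at h₁ ⊢
      constructor <;> linarith [h₁.1, h₁.2, h₂.1, h₂.2, h₃.1, h₃.2]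
  calc _ ≤ (F '' S ∪ G '' S).ncard :=
        Set.ncard_le_ncard sub ((hS.image F).union (hS.image G))
    _ ≤ (F '' S).ncard + (G '' S).ncard := Set.ncard_union_le _ _
    _ ≤ 2 * S.ncard := by
        have h₁ := Set.ncard_image_le (f := F) hS
        have h₂ := Set.ncard_image_le (f := G) hS
        omega

/-- Continuity of the discretized image of `ℤ^n` under small translations vanishing on the
rational rows of `A`. -/
theorem statement17 {n : ℕ} (ε : ℝ) (hε : 0 < ε)
    (A : Matrix (Fin n) (Fin n) ℝ) (hA : IsUnit A.det) :
    ∃ δ > 0, ∃ R₀ > 0, ∀ w : Fin n → ℝ, ‖w‖ < δ → (∀ i ∈ IQ A, w i = 0) →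
      ∀ R, R₀ ≤ R →
        DRplus (symmDiff
          (Set.range fun v : Fin n → ℤ => discretizeR (A.mulVec (intVec v)))
          (Set.range fun v : Fin n → ℤ => discretizeR (A.mulVec (intVec v) + w))) R ≤ ε := by
  classical
  obtain ⟨K, hK⟩ := exists_ncard_lattice_ball_le hA
  obtain ⟨M, hM⟩ := exists_nat_ge ((2 * n * K * 3 ^ n) / ε)
  rw [div_le_iff₀ hε] at hM
  obtain ⟨M, hM, hM0⟩ : ∃ M' : ℕ, (2 * n * K * 3 ^ n : ℝ) ≤ M' * ε ∧ 0 < M' := by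
    refine ⟨M + 1, hM.trans ?_, M.succ_pos⟩
    push_cast
    linarith
  have hM0' : (0 : ℝ) < M := by exact_mod_cast hM0
  obtain ⟨c, hc0, hc⟩ : ∃ c : ℝ, 0 ≤ c ∧ ∀ i j, |A i j| ≤ c := by
    refine ⟨∑ i, ∑ j, |A i j|, by positivity, fun i j => ?_⟩
    exact (Finset.single_le_sum (f := fun j => |A i j|) (fun _ _ => abs_nonneg _)
      (Finset.mem_univ j)).trans (Finset.single_le_sum (f := fun i => ∑ j, |A i j|)
        (fun _ _ => Finset.sum_nonneg fun _ _ => abs_nonneg _) (Finset.mem_univ i))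
  obtain ⟨δ, hδ, hδ0, hδ1⟩ : ∃ δ : ℝ, (∀ i, i ∉ IQ A → ∃ j, ∀ d : ℤ, d ≠ 0 → |d| < M →
      ∀ m : ℤ, 2 * δ ≤ |d * A i j - m|) ∧ 0 < δ ∧ δ < 1 := by
    have h : ∀ᶠ δ in nhdsWithin (0 : ℝ) (Set.Ioi 0), ∀ i, i ∉ IQ A → ∃ j, ∀ d : ℤ, d ≠ 0 →
        |d| < M → ∀ m : ℤ, 2 * δ ≤ |d * A i j - m| := by
      refine Filter.eventually_all.2 fun i => ?_
      by_cases hi : i ∈ IQ A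
      · simp [hi]
      · obtain ⟨j, hj⟩ := not_forall.1 hi
        have hirr : Irrational (A i j) := fun ⟨q, hq⟩ => hj ⟨q, hq.symm⟩
        filter_upwards [eventually_le_abs_mul_sub_int hirr M] with δ hδ _
        exact ⟨j, hδ⟩
    exact (h.and (Ioo_mem_nhdsGT one_pos)).exists
  have hMc : 0 ≤ M * c := by positivity
  refine ⟨δ, hδ0, 2 * (M * c) + 7, by positivity, fun w hw hwQ R hR => ?_⟩
  have hw' (i : Fin n) : |w i| < δ := (norm_le_pi_norm w i).trans_lt hw
  refine ciSup_le fun x => ?_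
  have hR1 : 1 ≤ R := by linarith
  have hR0 : 0 < R := by linarith
  rw [ncard_ball_inter_intPoints x hR0]
  have hden := le_card_intBox x hR1
  refine div_le_of_le_mul₀ (Nat.cast_nonneg _) hε.le ?_
  have h₁ := ncard_ball_inter_symmDiff_le A (fun i => (hw' i).trans hδ1) x hR0 (hK x _).1
  set S := {v : Fin n → ℤ | (∀ l, |A.mulVec (intVec v) l - x l| < R + 2) ∧
    discretize (A.mulVec (intVec v)) ≠ discretize (A.mulVec (intVec v) + w)}
  set N := {v : Fin n → ℤ | ∀ l, |A.mulVec (intVec v) l - x l| < R + 2 + M * c}.ncard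
  have hN : (N : ℝ) ≤ K * (3 ^ n * R ^ n) := by
    have h : (N : ℝ) ≤ K * (intBox x (R + 2 + M * c + 1)).card := by
      exact_mod_cast (hK x (R + 2 + M * c)).2
    refine h.trans (mul_le_mul_of_nonneg_left ?_ (Nat.cast_nonneg _))
    refine (card_intBox_le x (by linarith)).trans ?_
    rw [← mul_pow]
    exact pow_le_pow_left₀ (by linarith) (by linarith) n
  let S' : Fin n → Set (Fin n → ℤ) := fun i =>
    {v | (∀ l, |A.mulVec (intVec v) l - x l| < R + 2) ∧ i ∉ IQ A ∧
      ∃ m : ℤ, |A.mulVec (intVec v) i - 1 / 2 - m| < δ}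
  have hS' (i : Fin n) : M * (S' i).ncard ≤ N := by
    by_cases hi : i ∈ IQ A
    · simp [S', hi]
    · obtain ⟨j, hj⟩ := hδ i hi
      simpa [S', hi] using mul_ncard_near_half_le hc hj x (R + 2) (hK x _).1
  have hSS' : S ⊆ ⋃ i, S' i := by
    rintro v ⟨hv, hne⟩
    obtain ⟨i, hi⟩ := Function.ne_iff.1 hne
    have hiQ : i ∉ IQ A := fun h => hi (by simp [discretize, hwQ i h])
    exact Set.mem_iUnion.2 ⟨i, hv, hiQ, exists_abs_sub_half_lt_of_roundHalf_ne (hw' i) hi⟩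
  have hS : M * S.ncard ≤ n * N := by
    have hfin : (⋃ i, S' i).Finite :=
      Set.finite_iUnion fun i => (hK x (R + 2)).1.subset fun v hv => hv.1
    calc M * S.ncard ≤ M * ∑ i, (S' i).ncard := by
          refine Nat.mul_le_mul_left _ ((Set.ncard_le_ncard hSS' hfin).trans ?_)
          exact Set.ncard_iUnion_le_of_fintype _
      _ = ∑ i, M * (S' i).ncard := Finset.mul_sum _ _ _
      _ ≤ ∑ _i : Fin n, N := Finset.sum_le_sum fun i _ => hS' i
      _ = n * N := by simp
  refine le_of_mul_le_mul_left ?_ hM0'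
  calc (M : ℝ) * _ ≤ M * (2 * S.ncard) :=
        mul_le_mul_of_nonneg_left (by exact_mod_cast h₁) hM0'.le
    _ = 2 * ((M * S.ncard : ℕ) : ℝ) := by push_cast; ring
    _ ≤ 2 * ((n * N : ℕ) : ℝ) := by gcongr
    _ = 2 * n * N := by push_cast; ring
    _ ≤ 2 * n * (K * (3 ^ n * R ^ n)) := by gcongr
    _ = (2 * n * K * 3 ^ n) * R ^ n := by ring
    _ ≤ (M * ε) * (intBox x R).card := by gcongr
    _ = M * (ε * (intBox x R).card) := by ring

end
end
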